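/- D preserves algebraic vector fields: let S and S' be finite types and f : S → S' a function. Call a map v : (S → ℝ) → (S → ℝ) algebraic if there exists P : S → MvPolynomial S ℝ such that v(c)(σ) = eval c (P(σ)) for all c : S → ℝ and σ ∈ S. If v is algebraic, then D(f)(v) = f_* ∘ v ∘ f^* is algebraic: there exists Q : S' → MvPolynomial S' ℝ such that D(f)(v)(c)(σ') = eval c (Q(σ')) for all c : S' → ℝ and σ' ∈ S'. -/

import Mathlib

open scoped Classical

/-- The pushforward `f_*` of a function `c : S → ℝ` along `f : S → S'`:
`f_*(c)(σ') = ∑_{σ : f σ = σ'} c σ`. -/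
noncomputable def pushfwd {S S' : Type*} [Fintype S] (f : S → S') :
    (S → ℝ) → (S' → ℝ) :=
  fun c σ' => ∑ σ ∈ Finset.univ.filter (fun σ => f σ = σ'), c σ

/-- The pullback `f^*` of a function along `f : S → S'`: `f^*(c) = c ∘ f`. -/
def pullbk {S S' : Type*} (f : S → S') : (S' → ℝ) → (S → ℝ) := fun c => c ∘ f

/-- The assignment `D(f)(v) = f_* ∘ v ∘ f^*` on vector fields. -/
noncomputable def Dmap {S S' : Type*} [Fintype S] (f : S → S')
    (v : (S → ℝ) → (S → ℝ)) : (S' → ℝ) → (S' → ℝ) :=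
  fun c => pushfwd f (v (pullbk f c))

/-- `D` preserves algebraic vector fields. -/
theorem Dmap_algebraic {S S' : Type*} [Fintype S] [Fintype S'] (f : S → S')
    (v : (S → ℝ) → (S → ℝ))
    (hv : ∃ P : S → MvPolynomial S ℝ, ∀ (c : S → ℝ) (σ : S),
      v c σ = MvPolynomial.eval c (P σ)) :
    ∃ Q : S' → MvPolynomial S' ℝ, ∀ (c : S' → ℝ) (σ' : S'),
      Dmap f v c σ' = MvPolynomial.eval c (Q σ') := by
  obtain ⟨P, hP⟩ := hv
  refine ⟨fun σ' => ∑ σ ∈ Finset.univ.filter (fun σ => f σ = σ'),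
    MvPolynomial.rename f (P σ), fun c σ' => ?_⟩
  simp only [Dmap, pushfwd, pullbk, hP, map_sum, MvPolynomial.eval_rename]
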